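/- Let k₁ = 2 and 2 ≤ t ≤ min(k₂, d). If S ⊆ [2]×[k₂] contains no column slice C_j and has combinatorial type (u,v) with u > k₂ − t + 1 or v > k₂ − t + 1, then I_S is not minimal among {I_{S'} : S' ⊆ [2]×[k₂]}. -/

import Mathlib

noncomputable section

open MvPolynomial

namespace CI

/-- The column index set `[k₁] × [k₂]`. -/
abbrev Col (k₁ k₂ : ℕ) := Fin k₁ × Fin k₂

/-- The polynomial ring `ℂ[X]` in the entries of the `d × (k₁k₂)` matrix `X` of
indeterminates `x_{i,(j,ℓ)}`. -/
abbrev MvP (d k₁ k₂ : ℕ) := MvPolynomial (Fin d × Col k₁ k₂) ℂ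

/-- The `r × r` minor of `X` with rows `a` and columns `b`. -/
def minorPoly (d k₁ k₂ r : ℕ) (a : Fin r → Fin d) (b : Fin r → Col k₁ k₂) :
    MvP d k₁ k₂ :=
  (Matrix.of fun i j => (X (a i, b j) : MvP d k₁ k₂)).det

/-- `F_r(X_U)`: the set of all `r × r` minors of the submatrix `X_U`. -/
def minorSet (d k₁ k₂ r : ℕ) (U : Set (Col k₁ k₂)) : Set (MvP d k₁ k₂) :=
  { f | ∃ a : Fin r → Fin d, ∃ b : Fin r → Col k₁ k₂,
      Function.Injective a ∧ Function.Injective b ∧ (∀ i, b i ∈ U) ∧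
      f = minorPoly d k₁ k₂ r a b }

/-- `I_r(X_U)`: the ideal generated by the `r × r` minors of `X_U`. -/
def minorIdeal (d k₁ k₂ r : ℕ) (U : Set (Col k₁ k₂)) : Ideal (MvP d k₁ k₂) :=
  Ideal.span (minorSet d k₁ k₂ r U)

/-- The row slice `R_i = {i} × [k₂]`. -/
def rowSlice (k₁ k₂ : ℕ) (i : Fin k₁) : Set (Col k₁ k₂) := { p | p.1 = i }

/-- The column slice `C_j = [k₁] × {j}`. -/
def colSlice (k₁ k₂ : ℕ) (j : Fin k₂) : Set (Col k₁ k₂) := { p | p.2 = j }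

/-- The conditional independence ideal `𝓘_C = Σ_j I_2(X_{C_j}) + Σ_i I_t(X_{R_i})`. -/
def ciIdeal (d k₁ k₂ t : ℕ) : Ideal (MvP d k₁ k₂) :=
  (⨆ j : Fin k₂, minorIdeal d k₁ k₂ 2 (colSlice k₁ k₂ j)) ⊔
    ⨆ i : Fin k₁, minorIdeal d k₁ k₂ t (rowSlice k₁ k₂ i)

/-- `I_∅ = I_t(X) + Σ_j I_2(X_{C_j})`. -/
def Iempty (d k₁ k₂ t : ℕ) : Ideal (MvP d k₁ k₂) :=
  minorIdeal d k₁ k₂ t Set.univ ⊔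
    ⨆ j : Fin k₂, minorIdeal d k₁ k₂ 2 (colSlice k₁ k₂ j)

/-! ### The case `k₁ = 2`: the ideals `I_S` -/

/-- The column slice `C_j` does not meet `S`. -/
def colOK (k₂ : ℕ) (S : Set (Col 2 k₂)) (j : Fin k₂) : Prop := ∀ i : Fin 2, (i, j) ∉ S

/-- `𝒞(S)`: the union of all column slices not meeting `S`. -/
def CSet (k₂ : ℕ) (S : Set (Col 2 k₂)) : Set (Col 2 k₂) := { p | colOK k₂ S p.2 }

/-- The condition `Z(1,S) ∖ Z(2,S) ≠ ∅` and `Z(2,S) ∖ Z(1,S) ≠ ∅` under which the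
`(t-1)`-minors are included in `F_S`. -/
def tCond (k₂ : ℕ) (S : Set (Col 2 k₂)) : Prop :=
  (∃ ℓ, ((0 : Fin 2), ℓ) ∈ S ∧ ((1 : Fin 2), ℓ) ∉ S) ∧
  (∃ ℓ, ((1 : Fin 2), ℓ) ∈ S ∧ ((0 : Fin 2), ℓ) ∉ S)

/-- The generating set `F_S` of the ideal `I_S` (for `k₁ = 2`). -/
def FSset (d k₂ t : ℕ) (S : Set (Col 2 k₂)) : Set (MvP d 2 k₂) :=
  minorSet d 2 k₂ 1 S ∪
  (⋃ j ∈ { j : Fin k₂ | colOK k₂ S j }, minorSet d 2 k₂ 2 (colSlice 2 k₂ j)) ∪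
  (⋃ _ : tCond k₂ S, minorSet d 2 k₂ (t - 1) (CSet k₂ S)) ∪
  minorSet d 2 k₂ t ((rowSlice 2 k₂ 0 \ S) ∪ CSet k₂ S) ∪
  minorSet d 2 k₂ t ((rowSlice 2 k₂ 1 \ S) ∪ CSet k₂ S)

/-- The ideal `I_S ⊆ ℂ[X]` for `S ⊆ [2] × [k₂]`, generated by `F_S`. -/
def ISIdeal (d k₂ t : ℕ) (S : Set (Col 2 k₂)) : Ideal (MvP d 2 k₂) :=
  Ideal.span (FSset d k₂ t S)

/-- `u = min(|R₁ ∩ S|, |R₂ ∩ S|)`, the first entry of the combinatorial type of `S`. -/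
def uOf (k₂ : ℕ) (S : Set (Col 2 k₂)) : ℕ :=
  min ((rowSlice 2 k₂ 0 ∩ S).ncard) ((rowSlice 2 k₂ 1 ∩ S).ncard)

/-- `v = max(|R₁ ∩ S|, |R₂ ∩ S|)`, the second entry of the combinatorial type of `S`. -/
def vOf (k₂ : ℕ) (S : Set (Col 2 k₂)) : ℕ :=
  max ((rowSlice 2 k₂ 0 ∩ S).ncard) ((rowSlice 2 k₂ 1 ∩ S).ncard)

/-- `S` contains no column slice. -/
def noColumn (k₂ : ℕ) (S : Set (Col 2 k₂)) : Prop :=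
  ∀ j : Fin k₂, ¬ colSlice 2 k₂ j ⊆ S

/-- A subset `S ⊆ [2] × [k₂]` is minimal: `S = ∅`, or `S` contains no column slice,
its combinatorial type `(u,v)` satisfies `1 ≤ u ≤ v ≤ k₂ - t + 1`, and `u + v = k₂`
in case `t = 2`. -/
def minimalSubset (k₂ t : ℕ) (S : Set (Col 2 k₂)) : Prop :=
  S = ∅ ∨ (noColumn k₂ S ∧ 1 ≤ uOf k₂ S ∧ uOf k₂ S ≤ vOf k₂ S ∧
    vOf k₂ S ≤ k₂ - t + 1 ∧ (t = 2 → uOf k₂ S + vOf k₂ S = k₂))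

/-! ### Hypergraphs and their closure -/

/-- The hypergraph `H(S)` on `[k₁] × [k₂]`: its hyperedges are (1) the singletons of
elements of `S`; (2) the 2-subsets of a column slice disjoint from `S`; (3) the
`(t-1)`-subsets of `{i,j} × (NZ(i,S) ∩ NZ(j,S))` for distinct rows `i, j` with
`Z(i,S) ∖ Z(j,S) ≠ ∅` and `Z(j,S) ∖ Z(i,S) ≠ ∅`; (4) the `t`-subsets of a row slice
disjoint from `S`. -/
def HS (k₁ k₂ t : ℕ) (S : Set (Col k₁ k₂)) : Set (Finset (Col k₁ k₂)) :=
  { e | (∃ p ∈ S, e = {p})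
      ∨ (e.card = 2 ∧ (∃ j, ∀ p ∈ e, p.2 = j) ∧ ∀ p ∈ e, p ∉ S)
      ∨ (e.card = t - 1 ∧ ∃ i j : Fin k₁, i ≠ j ∧
           (∃ ℓ, (i, ℓ) ∈ S ∧ (j, ℓ) ∉ S) ∧ (∃ ℓ, (j, ℓ) ∈ S ∧ (i, ℓ) ∉ S) ∧
           ∀ p ∈ e, (p.1 = i ∨ p.1 = j) ∧ (i, p.2) ∉ S ∧ (j, p.2) ∉ S)
      ∨ (e.card = t ∧ (∃ i, ∀ p ∈ e, p.1 = i) ∧ ∀ p ∈ e, p ∉ S) }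

/-- The closure of a hypergraph: iterate the rule "if `{a,b}` and `e` (with `a ∈ e`)
are hyperedges, then add `(e ∖ {a}) ∪ {b}`". -/
inductive HClosure {k₁ k₂ : ℕ} (H : Set (Finset (Col k₁ k₂))) :
    Finset (Col k₁ k₂) → Prop
  | base {e : Finset (Col k₁ k₂)} : e ∈ H → HClosure H e
  | step {e : Finset (Col k₁ k₂)} (a b : Col k₁ k₂) :
      a ∈ e → HClosure H {a, b} → HClosure H e → HClosure H (insert b (e.erase a))

/-- The determinantal ideal of a hypergraph: it is generated by the minors `[A|B]`
with `A ⊆ [d]`, `B` a hyperedge, and `|A| = |B|`. -/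
def hypIdeal (d k₁ k₂ : ℕ) (H : Set (Finset (Col k₁ k₂))) : Ideal (MvP d k₁ k₂) :=
  Ideal.span { f | ∃ e ∈ H, ∃ a : Fin e.card → Fin d, ∃ b : Fin e.card → Col k₁ k₂,
      Function.Injective a ∧ Function.Injective b ∧ (∀ i, b i ∈ e) ∧
      f = minorPoly d k₁ k₂ e.card a b }

/-- The ideal `I_S` associated to the closure of the hypergraph `H(S)`. -/
def ISclosure (d k₁ k₂ t : ℕ) (S : Set (Col k₁ k₂)) : Ideal (MvP d k₁ k₂) :=
  hypIdeal d k₁ k₂ { e | HClosure (HS k₁ k₂ t S) e }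

/-! ### The lexicographic monomial order -/

/-- `varLT a b` means the variable `x_a` is *larger* than `x_b` in the variable order
`x_{1,(1,1)} > x_{2,(1,1)} > ⋯ > x_{d,(1,1)} > x_{1,(2,1)} > ⋯ > x_{d,(k₁,k₂)}`,
i.e. `(ℓ, j, i)` precedes `(ℓ', j', i')` lexicographically, where `a = (i, (j, ℓ))`. -/
def varLT (d k₁ k₂ : ℕ) (a b : Fin d × Col k₁ k₂) : Prop :=
  Prod.Lex (· < ·) (Prod.Lex (· < ·) (· < ·))
    (a.2.2, (a.2.1, a.1)) (b.2.2, (b.2.1, b.1))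

/-- `m ≺ m'` in the lexicographic monomial order determined by the variable order:
at the largest variable where the exponents differ, `m` has the smaller exponent. -/
def monLT (d k₁ k₂ : ℕ) (m m' : (Fin d × Col k₁ k₂) →₀ ℕ) : Prop :=
  ∃ v, (∀ w, varLT d k₁ k₂ w v → m w = m' w) ∧ m v < m' v

/-- `m` is the `≺`-leading monomial of `f`. -/
def IsLeadMon (d k₁ k₂ : ℕ) (f : MvP d k₁ k₂) (m : (Fin d × Col k₁ k₂) →₀ ℕ) : Prop :=
  m ∈ f.support ∧ ∀ m' ∈ f.support, m' = m ∨ monLT d k₁ k₂ m' m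

/-- `G` is a Gröbner basis of `I` with respect to the lexicographic order `≺`:
`G` is contained in `I` and for every nonzero `f ∈ I` there is a `g ∈ G` whose
`≺`-leading monomial divides the `≺`-leading monomial of `f`. -/
def IsGB (d k₁ k₂ : ℕ) (G : Set (MvP d k₁ k₂)) (I : Ideal (MvP d k₁ k₂)) : Prop :=
  G ⊆ (I : Set (MvP d k₁ k₂)) ∧ ∀ f ∈ I, f ≠ 0 →
    ∃ g ∈ G, ∃ mg, IsLeadMon d k₁ k₂ g mg ∧
      ∀ mf, IsLeadMon d k₁ k₂ f mf → ∀ x, mg x ≤ mf x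

/-! ### The matrix `D_A` -/

/-- For `A ∈ ℂ^{k₂ × (k₁-1)}`, the `k₂ × (k₁k₂)` matrix `D_A`: its row `r` has entry
`1` in the column indexed by `(1, r)`, entry `A r ℓ` in the column indexed by
`(1+ℓ, r)` for `ℓ ∈ [k₁-1]`, and zeros elsewhere. -/
def DMat (k₁ k₂ : ℕ) (A : Matrix (Fin k₂) (Fin (k₁ - 1)) ℂ) :
    Matrix (Fin k₂) (Col k₁ k₂) ℂ := fun r c =>
  if c.2 = r then
    (if _h : (c.1 : ℕ) = 0 then 1
     else A r ⟨(c.1 : ℕ) - 1, by have := c.1.isLt; omega⟩)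
  else 0

end CI

namespace CI

/-- A determinant vanishes as soon as all the `2 × 2` minors of two of its columns do. -/
theorem det_eq_zero_of_two_columns {n R : Type*} [Fintype n] [DecidableEq n] [CommRing R]
    (M : Matrix n n R) {p q : n} (hpq : p ≠ q)
    (h : ∀ r s, r ≠ s → M r p * M s q = M r q * M s p) : M.det = 0 := by
  rw [Matrix.det_apply]
  refine Finset.sum_involution (fun σ _ => σ * Equiv.swap p q) (fun σ _ => ?_)
    (fun σ _ _ => (not_congr mul_eq_left).mpr (mt Equiv.swap_eq_one_iff.mp hpq))
    (fun _ _ => Finset.mem_univ _) (fun σ _ => by simp [mul_assoc])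
  have hq : q ∈ Finset.univ.erase p := by simp [hpq.symm]
  have hprod : ∏ j, M ((σ * Equiv.swap p q) j) j = ∏ j, M (σ j) j := by
    rw [← Finset.mul_prod_erase _ _ (Finset.mem_univ p), ← Finset.mul_prod_erase _ _ hq,
      ← Finset.mul_prod_erase _ _ (Finset.mem_univ p), ← Finset.mul_prod_erase _ _ hq,
      ← mul_assoc, ← mul_assoc]
    congr 1
    · have := h (σ p) (σ q) (σ.injective.ne hpq)
      simp only [Equiv.Perm.mul_apply, Equiv.swap_apply_left, Equiv.swap_apply_right]
      rw [this, mul_comm]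
    · refine Finset.prod_congr rfl fun j hj => ?_
      rw [Finset.mem_erase, Finset.mem_erase] at hj
      rw [Equiv.Perm.mul_apply, Equiv.swap_apply_of_ne_of_ne hj.2.1 hj.1]
  rw [hprod]
  simp [Equiv.Perm.sign_mul, Equiv.Perm.sign_swap hpq]

theorem X_mem_ISIdeal (d k₂ t : ℕ) {S : Set (Col 2 k₂)} {c : Col 2 k₂} (hc : c ∈ S)
    (r : Fin d) : (X (r, c) : MvP d 2 k₂) ∈ ISIdeal d k₂ t S := by
  refine Ideal.subset_span (Or.inl (Or.inl (Or.inl (Or.inl ⟨fun _ => r, fun _ => c,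
    Function.injective_of_subsingleton _, Function.injective_of_subsingleton _,
    fun _ => hc, ?_⟩))))
  simp [minorPoly]

theorem minorPoly_mem_of_row (d k₂ t : ℕ) (S : Set (Col 2 k₂)) (i : Fin 2)
    {a : Fin t → Fin d} {b : Fin t → Col 2 k₂} (ha : Function.Injective a)
    (hb : Function.Injective b) (h : ∀ p, b p ∈ (rowSlice 2 k₂ i \ S) ∪ CSet k₂ S) :
    minorPoly d 2 k₂ t a b ∈ ISIdeal d k₂ t S := by
  have hm : minorPoly d 2 k₂ t a b ∈
      minorSet d 2 k₂ t ((rowSlice 2 k₂ i \ S) ∪ CSet k₂ S) := ⟨a, b, ha, hb, h, rfl⟩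
  fin_cases i
  · exact Ideal.subset_span (Or.inl (Or.inr hm))
  · exact Ideal.subset_span (Or.inr hm)

/-- A minor with a column in `S` lies in `I_S`. -/
theorem minorPoly_mem_of_mem (d k₂ t : ℕ) {S : Set (Col 2 k₂)} {n : ℕ}
    (a : Fin n → Fin d) (b : Fin n → Col 2 k₂) {p : Fin n} (hp : b p ∈ S) :
    minorPoly d 2 k₂ n a b ∈ ISIdeal d k₂ t S := by
  rw [← Ideal.Quotient.eq_zero_iff_mem, minorPoly, RingHom.map_det]
  exact Matrix.det_eq_zero_of_column_eq_zero p fun r =>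
    Ideal.Quotient.eq_zero_iff_mem.mpr (X_mem_ISIdeal d k₂ t hp (a r))

/-- A minor with two different columns in the same column slice lies in `I_S`. -/
theorem minorPoly_mem_of_snd_eq (d k₂ t : ℕ) (S : Set (Col 2 k₂)) {n : ℕ}
    {a : Fin n → Fin d} {b : Fin n → Col 2 k₂} (ha : Function.Injective a)
    (hb : Function.Injective b) {p q : Fin n} (hpq : p ≠ q) (h : (b p).2 = (b q).2) :
    minorPoly d 2 k₂ n a b ∈ ISIdeal d k₂ t S := by
  by_cases hS : b p ∈ S ∨ b q ∈ S
  · rcases hS with hS | hS <;> exact minorPoly_mem_of_mem d k₂ t a b hS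
  push Not at hS
  have hfst : (b p).1 ≠ (b q).1 := fun h1 => hpq (hb (Prod.ext h1 h))
  have hOK : colOK k₂ S (b p).2 := by
    intro i
    have hi : i = (b p).1 ∨ i = (b q).1 := by omega
    rcases hi with rfl | rfl
    · exact hS.1
    · rw [h]; exact hS.2
  rw [← Ideal.Quotient.eq_zero_iff_mem, minorPoly, RingHom.map_det]
  refine det_eq_zero_of_two_columns _ hpq fun r s hrs => ?_
  have hm : minorPoly d 2 k₂ 2 ![a r, a s] ![b p, b q] ∈ ISIdeal d k₂ t S := by
    refine Ideal.subset_span (Or.inl (Or.inl (Or.inl (Or.inr ?_))))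
    refine Set.mem_biUnion (x := (b p).2) hOK ⟨_, _, ?_, ?_, ?_, rfl⟩
    · simpa [Function.Injective, Fin.forall_fin_two, eq_comm] using ha.ne hrs
    · simpa [Function.Injective, Fin.forall_fin_two, eq_comm] using hb.ne hpq
    · simp [Fin.forall_fin_two, colSlice, h]
  rw [minorPoly, Matrix.det_fin_two] at hm
  simpa [← map_mul] using (Ideal.Quotient.eq.mpr hm)

/-- A minor whose columns avoid too many column slices lies in `I_S`. -/
theorem minorPoly_mem_of_card (d k₂ t : ℕ) (S : Set (Col 2 k₂)) {n : ℕ}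
    {a : Fin n → Fin d} {b : Fin n → Col 2 k₂} (ha : Function.Injective a)
    (hb : Function.Injective b) {B : Finset (Fin k₂)} (hB : ∀ p, (b p).2 ∉ B)
    (hcard : k₂ < n + B.card) :
    minorPoly d 2 k₂ n a b ∈ ISIdeal d k₂ t S := by
  by_contra hmem
  have hinj : Function.Injective fun p => (b p).2 := fun p q h => by
    by_contra hpq
    exact hmem (minorPoly_mem_of_snd_eq d k₂ t S ha hb hpq h)
  have hle := Finset.card_le_card_of_injOn (s := Finset.univ) (t := Bᶜ) (fun p => (b p).2)
    (fun p _ => by simpa using hB p) hinj.injOn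
  rw [Finset.card_univ, Fintype.card_fin, Finset.card_compl, Fintype.card_fin] at hle
  have := B.card_le_univ
  rw [Fintype.card_fin] at this
  omega

/-- A minor having a column other than `c` vanishes where all columns but `c` are zero. -/
theorem eval_minorPoly_eq_zero (d k₂ : ℕ) {n : ℕ} (c : Col 2 k₂) (a : Fin n → Fin d)
    (b : Fin n → Col 2 k₂) {p : Fin n} (hp : b p ≠ c) :
    eval (fun x : Fin d × Col 2 k₂ => if x.2 = c then (1 : ℂ) else 0)
      (minorPoly d 2 k₂ n a b) = 0 := by
  rw [minorPoly, RingHom.map_det]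
  exact Matrix.det_eq_zero_of_column_eq_zero p fun r => by simp [hp]

theorem X_notMem_ISIdeal (d k₂ t : ℕ) (ht : 2 ≤ t) {S : Set (Col 2 k₂)} {c : Col 2 k₂}
    (hc : c ∉ S) (hS : t = 2 → ¬ tCond k₂ S) (r : Fin d) :
    (X (r, c) : MvP d 2 k₂) ∉ ISIdeal d k₂ t S := by
  intro hmem
  have hle : ISIdeal d k₂ t S ≤
      RingHom.ker (eval fun x : Fin d × Col 2 k₂ => if x.2 = c then (1 : ℂ) else 0) := by
    have key : ∀ n : ℕ, 2 ≤ n → ∀ U f, f ∈ minorSet d 2 k₂ n U →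
        eval (fun x : Fin d × Col 2 k₂ => if x.2 = c then (1 : ℂ) else 0) f = 0 := by
      rintro n hn U _ ⟨a, b, -, hb, -, rfl⟩
      by_cases h0 : b ⟨0, by omega⟩ = c
      · refine eval_minorPoly_eq_zero d k₂ c a b (p := ⟨1, by omega⟩) fun h1 => ?_
        simpa using hb (h0.trans h1.symm)
      · exact eval_minorPoly_eq_zero d k₂ c a b h0
    refine Ideal.span_le.mpr ?_
    rintro f ((((hf | hf) | hf) | hf) | hf)
    · obtain ⟨a, b, -, -, hb, rfl⟩ := hf
      exact eval_minorPoly_eq_zero d k₂ c a b (p := 0) fun h => hc (h ▸ hb 0)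
    · obtain ⟨j, -, hf⟩ := Set.mem_iUnion₂.mp hf
      exact key 2 le_rfl _ f hf
    · obtain ⟨hT, hf⟩ := Set.mem_iUnion.mp hf
      have : t ≠ 2 := fun h => hS h hT
      exact key (t - 1) (by omega) _ f hf
    · exact key t ht _ f hf
    · exact key t ht _ f hf
  have := hle hmem
  simp [RingHom.mem_ker] at this

/-- If row `i` has more than `k₂ - t + 1` elements in `S`, removing any of them from `S`
makes the ideal strictly smaller. -/
theorem ISIdeal_diff_singleton_lt (d k₂ t : ℕ) (ht : 2 ≤ t) (htk : t ≤ k₂) (htd : t ≤ d)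
    {S : Set (Col 2 k₂)} (hcol : noColumn k₂ S) {i : Fin 2}
    (hbig : k₂ - t + 1 < (rowSlice 2 k₂ i ∩ S).ncard) {ℓ : Fin k₂} (hℓ : (i, ℓ) ∈ S) :
    ISIdeal d k₂ t (S \ {(i, ℓ)}) < ISIdeal d k₂ t S := by
  classical
  set S' := S \ {(i, ℓ)} with hS'
  have hsub : S' ⊆ S := Set.sdiff_subset
  set A : Finset (Fin k₂) := Finset.univ.filter fun j => (i, j) ∈ S with hA
  have hAcard : A.card = (rowSlice 2 k₂ i ∩ S).ncard := by
    have : rowSlice 2 k₂ i ∩ S = (fun j => (i, j)) '' (A : Set (Fin k₂)) := by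
      ext ⟨x, y⟩
      simp only [rowSlice, hA, Set.mem_inter_iff, Set.mem_ofPred_eq, Finset.coe_filter,
        Finset.mem_univ, true_and, Set.mem_image, Prod.mk.injEq]
      constructor
      · rintro ⟨rfl, h⟩; exact ⟨y, h, rfl, rfl⟩
      · rintro ⟨j, h, rfl, rfl⟩; exact ⟨rfl, h⟩
    rw [this, Set.ncard_image_of_injective _ (Prod.mk_right_injective i), Set.ncard_coe_finset]
  have hℓA : ℓ ∈ A := by simp [hA, hℓ]
  have herase : (A.erase ℓ).card + 1 = A.card := Finset.card_erase_add_one hℓA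
  have hmem_erase : ∀ j ∈ A.erase ℓ, (i, j) ∈ S' := by
    intro j hj
    simp only [hA, Finset.mem_erase, Finset.mem_filter, Finset.mem_univ, true_and] at hj
    exact ⟨hj.2, by simp [hj.1]⟩
  have hother : ∀ i' j, i' ≠ i → (i', j) ∈ S → (i, j) ∉ S := by
    intro i' j hi' h' h
    refine hcol j ?_
    rintro ⟨x, y⟩ hy
    obtain rfl : y = j := hy
    have hx : x = i ∨ x = i' := by omega
    rcases hx with rfl | rfl <;> assumption
  have htcond : tCond k₂ S' → ∃ m, m ∉ A ∧ ∃ i', (i', m) ∈ S' := by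
    intro hT
    obtain ⟨m, i', hi', hm⟩ : ∃ m i', i' ≠ i ∧ (i', m) ∈ S' := by
      obtain ⟨⟨m₀, h₀, -⟩, m₁, h₁, -⟩ := hT
      by_cases hi : i = 0
      · exact ⟨m₁, 1, by omega, h₁⟩
      · exact ⟨m₀, 0, Ne.symm hi, h₀⟩
    exact ⟨m, by simpa [hA] using hother i' m hi' (hsub hm), i', hm⟩
  have hℓS' : (i, ℓ) ∉ S' := by simp [hS']
  refine lt_of_le_of_ne (Ideal.span_le.mpr ?_) fun heq => ?_
  · have hrow : ∀ x, minorSet d 2 k₂ t ((rowSlice 2 k₂ x \ S') ∪ CSet k₂ S') ⊆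
        (ISIdeal d k₂ t S : Set (MvP d 2 k₂)) := by
      rintro x _ ⟨a, b, ha, hb, hU, rfl⟩
      by_cases hx : x = i
      · subst hx
        refine minorPoly_mem_of_card d k₂ t S ha hb (B := A.erase ℓ) (fun p hp => ?_) (by omega)
        have hp' := hmem_erase _ hp
        rcases hU p with ⟨h1, h2⟩ | h
        · obtain rfl : (b p).1 = x := h1
          exact h2 hp'
        · exact h _ hp'
      · by_cases hbS : ∃ p, b p ∈ S
        · obtain ⟨p, hp⟩ := hbS
          exact minorPoly_mem_of_mem d k₂ t a b hp
        push Not at hbS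
        refine minorPoly_mem_of_row d k₂ t S x ha hb fun p => ?_
        rcases hU p with ⟨h1, -⟩ | h
        · exact Or.inl ⟨h1, hbS p⟩
        · by_cases hp1 : (b p).1 = x
          · exact Or.inl ⟨hp1, hbS p⟩
          · have hpi : (b p).1 = i := by omega
            refine Or.inr fun y hy => ?_
            by_cases hyℓ : (y, (b p).2) = (i, ℓ)
            · refine hbS p ?_
              have : b p = (i, ℓ) := Prod.ext hpi (Prod.mk.inj hyℓ).2
              rwa [this]
            · exact h y ⟨hy, hyℓ⟩
    rintro f ((((hf | hf) | hf) | hf) | hf)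
    · obtain ⟨a, b, -, -, hb, rfl⟩ := hf
      exact minorPoly_mem_of_mem d k₂ t a b (hsub (hb 0))
    · obtain ⟨j, -, a, b, ha, hb, hU, rfl⟩ := Set.mem_iUnion₂.mp hf
      exact minorPoly_mem_of_snd_eq d k₂ t S ha hb (p := 0) (q := 1) (by decide)
        ((hU 0).trans (hU 1).symm)
    · obtain ⟨hT, a, b, ha, hb, hU, rfl⟩ := Set.mem_iUnion.mp hf
      obtain ⟨m, hm, i', hm'⟩ := htcond hT
      have hm_erase : m ∉ A.erase ℓ := fun h => hm (Finset.mem_of_mem_erase h)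
      refine minorPoly_mem_of_card d k₂ t S ha hb (B := insert m (A.erase ℓ))
        (fun p hp => ?_) (by rw [Finset.card_insert_of_notMem hm_erase]; omega)
      rcases Finset.mem_insert.mp hp with h | h
      · exact hU p i' (h ▸ hm')
      · exact hU p i (hmem_erase _ h)
    · exact hrow 0 hf
    · exact hrow 1 hf
  · refine X_notMem_ISIdeal d k₂ t ht hℓS' (fun h2 hT => ?_) ⟨0, by omega⟩
      (heq ▸ X_mem_ISIdeal d k₂ t hℓ _)
    obtain ⟨m, hm, -⟩ := htcond hT
    have := Finset.card_le_univ (insert m A)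
    rw [Finset.card_insert_of_notMem hm, Fintype.card_fin] at this
    omega

/-- if `S` contains no column slice and has combinatorial type
`(u,v)` with `u > k₂ - t + 1` or `v > k₂ - t + 1`, then `I_S` is not minimal among
`{I_{S'} : S' ⊆ [2]×[k₂]}`. -/
theorem not_minimal_of_type_large
    (d k₂ t : ℕ) (ht : 2 ≤ t) (htk : t ≤ k₂) (htd : t ≤ d)
    (S : Set (Col 2 k₂)) (hcol : noColumn k₂ S)
    (hbig : k₂ - t + 1 < uOf k₂ S ∨ k₂ - t + 1 < vOf k₂ S) :
    ∃ S' : Set (Col 2 k₂), ISIdeal d k₂ t S' < ISIdeal d k₂ t S := by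
  have hrow : ∃ i, k₂ - t + 1 < (rowSlice 2 k₂ i ∩ S).ncard := by
    simp only [uOf, vOf, lt_min_iff, lt_max_iff] at hbig
    rcases hbig with h | h | h
    exacts [⟨0, h.1⟩, ⟨0, h⟩, ⟨1, h⟩]
  obtain ⟨i, hi⟩ := hrow
  obtain ⟨⟨x, ℓ⟩, hx, hℓ⟩ := Set.nonempty_of_ncard_ne_zero (Nat.ne_zero_of_lt hi)
  obtain rfl : x = i := hx
  exact ⟨_, ISIdeal_diff_singleton_lt d k₂ t ht htk htd hcol hi hℓ⟩

end CI
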